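/- Let E be a Banach space, let f : ℝ^d → E be a Lebesgue measurable function, let Q ⊆ ℝ^d be a Lebesgue measurable set with 0 < |Q| < ∞, and let 0 < λ ≤ κ < 1/2. Then for every quasi-optimal center of oscillation m of f on Q with a κ-portion disregarded and for every c ∈ E, one has ρ_λ(f − m; Q) ≤ 4 ρ_λ(f − c; Q). -/

import Mathlib

open MeasureTheory Set

/-- The least bound `ρ_λ(f;Q)`: the infimum of all `r ≥ 0` such that
`|{x ∈ Q : ‖f(x)‖ > r}| ≤ λ|Q|`. -/
noncomputable def leastBound {E : Type*} [NormedAddCommGroup E] {d : ℕ} (lam : ℝ)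
    (f : (Fin d → ℝ) → E) (Q : Set (Fin d → ℝ)) : ℝ :=
  sInf {r : ℝ | 0 ≤ r ∧ volume {x ∈ Q | r < ‖f x‖} ≤ ENNReal.ofReal lam * volume Q}

/-- The local oscillation `ω_λ(f;Q) := inf_{c ∈ E} ρ_λ(f - c; Q)`. -/
noncomputable def localOsc {E : Type*} [NormedAddCommGroup E] {d : ℕ} (lam : ℝ)
    (f : (Fin d → ℝ) → E) (Q : Set (Fin d → ℝ)) : ℝ :=
  ⨅ c : E, leastBound lam (fun x => f x - c) Q

/-- A quasi-optimal center of oscillation of `f` on `Q` with a `λ`-portion disregarded: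
any `m ∈ E` with `ρ_λ(f - m; Q) ≤ 2 ω_λ(f;Q)`. -/
def IsQuasiCenter {E : Type*} [NormedAddCommGroup E] {d : ℕ} (lam : ℝ)
    (f : (Fin d → ℝ) → E) (Q : Set (Fin d → ℝ)) (m : E) : Prop :=
  leastBound lam (fun x => f x - m) Q ≤ 2 * localOsc lam f Q

/-- On a set of finite measure, an a.e. strongly measurable function exceeds a large enough bound
only on a set of measure at most `ε`. -/
theorem exists_measure_norm_gt_le {α E : Type*} [MeasurableSpace α] {μ : Measure α}
    [NormedAddCommGroup E] {g : α → E} (hg : AEStronglyMeasurable g μ) {Q : Set α}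
    (hQ : NullMeasurableSet Q μ) (hQfin : μ Q ≠ ⊤) {ε : ENNReal} (hε : 0 < ε) :
    ∃ r : ℝ, 0 ≤ r ∧ μ {x ∈ Q | r < ‖g x‖} ≤ ε := by
  have hmeas (n : ℕ) : NullMeasurableSet {x ∈ Q | (n : ℝ) < ‖g x‖} μ :=
    hQ.inter (nullMeasurableSet_lt aemeasurable_const hg.norm.aemeasurable)
  have hanti : Antitone fun n : ℕ => {x ∈ Q | (n : ℝ) < ‖g x‖} := fun a b hab x hx =>
    ⟨hx.1, (Nat.cast_le.2 hab).trans_lt hx.2⟩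
  have hempty : ⋂ n : ℕ, {x ∈ Q | (n : ℝ) < ‖g x‖} = ∅ := by
    refine eq_empty_of_forall_notMem fun x hx => ?_
    obtain ⟨n, hn⟩ := exists_nat_gt ‖g x‖
    exact hn.not_gt (mem_iInter.1 hx n).2
  have hlim := tendsto_measure_iInter_atTop hmeas hanti
    ⟨0, measure_ne_top_of_subset (sep_subset _ _) hQfin⟩
  rw [hempty, measure_empty] at hlim
  obtain ⟨n, hn⟩ := (hlim.eventually_le_const hε).exists
  exact ⟨n, n.cast_nonneg, hn⟩

section LeastBound

variable {E : Type*} [NormedAddCommGroup E] {d : ℕ} {f : (Fin d → ℝ) → E} {Q : Set (Fin d → ℝ)}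

theorem leastBound_le {lam r : ℝ} (hr : 0 ≤ r)
    (h : volume {x ∈ Q | r < ‖f x‖} ≤ ENNReal.ofReal lam * volume Q) : leastBound lam f Q ≤ r :=
  csInf_le ⟨0, fun _ hs => hs.1⟩ ⟨hr, h⟩

theorem leastBound_nonneg (lam : ℝ) (f : (Fin d → ℝ) → E) (Q : Set (Fin d → ℝ)) :
    0 ≤ leastBound lam f Q :=
  Real.sInf_nonneg fun _ hs => hs.1

theorem le_leastBound {lam b : ℝ} (hf : AEStronglyMeasurable f volume) (hQ : MeasurableSet Q)
    (hQpos : 0 < volume Q) (hQfin : volume Q < ⊤) (hlam : 0 < lam)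
    (h : ∀ r : ℝ, 0 ≤ r → volume {x ∈ Q | r < ‖f x‖} ≤ ENNReal.ofReal lam * volume Q → b ≤ r) :
    b ≤ leastBound lam f Q :=
  le_csInf (exists_measure_norm_gt_le hf hQ.nullMeasurableSet hQfin.ne
    (ENNReal.mul_pos (ENNReal.ofReal_pos.2 hlam).ne' hQpos.ne')) fun r hr => h r hr.1 hr.2

theorem localOsc_le_leastBound (lam : ℝ) (f : (Fin d → ℝ) → E) (Q : Set (Fin d → ℝ)) (c : E) :
    localOsc lam f Q ≤ leastBound lam (fun x => f x - c) Q :=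
  ciInf_le ⟨0, by rintro _ ⟨c, rfl⟩; exact leastBound_nonneg _ _ _⟩ c

/-- If `f` lies within `s` of `m` and within `r` of `c` off subsets of `Q` of relative measure less
than one half, then these balls meet. -/
theorem norm_sub_le_of_measure_le {kap r s : ℝ} {m c : E} (hkap : kap < 1 / 2)
    (hQpos : 0 < volume Q) (hQfin : volume Q < ⊤)
    (hs : volume {x ∈ Q | s < ‖f x - m‖} ≤ ENNReal.ofReal kap * volume Q)
    (hr : volume {x ∈ Q | r < ‖f x - c‖} ≤ ENNReal.ofReal kap * volume Q) :
    ‖m - c‖ ≤ s + r := by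
  have hlt : volume ({x ∈ Q | s < ‖f x - m‖} ∪ {x ∈ Q | r < ‖f x - c‖}) < volume Q :=
    calc
      _ ≤ ENNReal.ofReal kap * volume Q + ENNReal.ofReal kap * volume Q :=
        (measure_union_le _ _).trans (add_le_add hs hr)
      _ = (ENNReal.ofReal kap + ENNReal.ofReal kap) * volume Q := (add_mul _ _ _).symm
      _ < 1 * volume Q := by
        refine ENNReal.mul_lt_mul_left hQpos.ne' hQfin.ne ?_
        have h : ENNReal.ofReal kap < ENNReal.ofReal (1 / 2) :=
          (ENNReal.ofReal_lt_ofReal_iff (by norm_num)).2 hkap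
        calc
          _ < ENNReal.ofReal (1 / 2) + ENNReal.ofReal (1 / 2) := ENNReal.add_lt_add h h
          _ = 1 := by rw [← ENNReal.ofReal_add] <;> norm_num
      _ = volume Q := one_mul _
  obtain ⟨x, hxQ, hx⟩ : ∃ x ∈ Q, x ∉ {x ∈ Q | s < ‖f x - m‖} ∪ {x ∈ Q | r < ‖f x - c‖} :=
    not_subset.1 fun h => hlt.not_ge (measure_mono h)
  have hxs : ‖f x - m‖ ≤ s := not_lt.1 fun h => hx (.inl ⟨hxQ, h⟩)
  have hxr : ‖f x - c‖ ≤ r := not_lt.1 fun h => hx (.inr ⟨hxQ, h⟩)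
  calc
    ‖m - c‖ ≤ ‖m - f x‖ + ‖f x - c‖ := norm_sub_le_norm_sub_add_norm_sub _ _ _
    _ ≤ s + r := add_le_add (by rwa [norm_sub_rev]) hxr

/-- Moving the center from `c` to `m` changes an admissible bound by at most `‖m - c‖`. -/
theorem leastBound_sub_le_add_norm {lam r : ℝ} {m c : E} (hr : 0 ≤ r)
    (h : volume {x ∈ Q | r < ‖f x - c‖} ≤ ENNReal.ofReal lam * volume Q) :
    leastBound lam (fun x => f x - m) Q ≤ r + ‖m - c‖ := by
  refine leastBound_le (by positivity) (le_trans (measure_mono ?_) h)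
  rintro x ⟨hxQ, hx⟩
  refine ⟨hxQ, ?_⟩
  have := norm_sub_le_norm_sub_add_norm_sub (f x) c m
  rw [norm_sub_rev c m] at this
  linarith

end LeastBound

/-- for `0 < λ ≤ κ < 1/2`, any quasi-optimal center of oscillation `m`
of `f` on `Q` with a `κ`-portion disregarded satisfies
`ρ_λ(f - m; Q) ≤ 4 ρ_λ(f - c; Q)` for every `c ∈ E`. -/
theorem leastBound_quasiCenter_le_four_leastBound {E : Type*} [NormedAddCommGroup E]
    [NormedSpace ℝ E] [CompleteSpace E] {d : ℕ}
    (f : (Fin d → ℝ) → E) (hf : AEStronglyMeasurable f volume)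
    (Q : Set (Fin d → ℝ)) (hQmeas : MeasurableSet Q)
    (hQpos : 0 < volume Q) (hQfin : volume Q < ⊤)
    (lam kap : ℝ) (hlam0 : 0 < lam) (hlk : lam ≤ kap) (hkap : kap < 1 / 2)
    (m : E) (hm : IsQuasiCenter kap f Q m) (c : E) :
    leastBound lam (fun x => f x - m) Q ≤ 4 * leastBound lam (fun x => f x - c) Q := by
  have hkap0 : 0 < kap := hlam0.trans_le hlk
  suffices h : leastBound lam (fun x => f x - m) Q / 4 ≤ leastBound lam (fun x => f x - c) Q by
    linarith
  refine le_leastBound (hf.sub aestronglyMeasurable_const) hQmeas hQpos hQfin hlam0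
    fun r hr0 hr => ?_
  have hr' : volume {x ∈ Q | r < ‖f x - c‖} ≤ ENNReal.ofReal kap * volume Q :=
    hr.trans (by gcongr)
  have hmove := leastBound_sub_le_add_norm (m := m) hr0 hr
  have hdist : ‖m - c‖ - r ≤ leastBound kap (fun x => f x - m) Q :=
    le_leastBound (hf.sub aestronglyMeasurable_const) hQmeas hQpos hQfin hkap0 fun s _ hs => by
      linarith [norm_sub_le_of_measure_le hkap hQpos hQfin hs hr']
  have hosc : localOsc kap f Q ≤ r :=
    (localOsc_le_leastBound kap f Q c).trans (leastBound_le hr0 hr')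
  have hcenter : leastBound kap (fun x => f x - m) Q ≤ 2 * localOsc kap f Q := hm
  linarith
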